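/- arXiv:0810.2799 — 2 statements merged into one kernel-verified Lean document; each statement's English description precedes it below -/
import Mathlib

section
/- The image under the toric moment map of the SO(6)-conjugation orbit of J₀ (the orbit parametrizing orthogonal almost complex structures compatible with the standard orientation of ℝ⁶) is the solid tetrahedron: {μ(P J₀ Pᵀ) : P ∈ SO(6)} = {(x,y,z) ∈ ℝ³ : x+y+z ≥ −1, x−y−z ≥ −1, −x+y−z ≥ −1, −x−y+z ≥ −1}. -/
open Matrix

noncomputable section

/-- The skew-symmetric matrix of the 2-form `eⁱ ∧ eʲ`:
`E i j` sends `e i ↦ e j`, `e j ↦ -e i`, and kills the other basis vectors. -/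
def E (i j : Fin 6) : Matrix (Fin 6) (Fin 6) ℝ := fun k l =>
  (if k = j ∧ l = i then (1 : ℝ) else 0) - (if k = i ∧ l = j then (1 : ℝ) else 0)

/-- The standard orthogonal complex structure `J₀ = E₁₂ + E₃₄ + E₅₆`. -/
def J₀ : Matrix (Fin 6) (Fin 6) ℝ := E 0 1 + E 2 3 + E 4 5

/-- The toric moment map `μ(A) = (⟨Ae₁,e₂⟩, ⟨Ae₃,e₄⟩, ⟨Ae₅,e₆⟩)`. -/
def μ (A : Matrix (Fin 6) (Fin 6) ℝ) : ℝ × ℝ × ℝ := (A 1 0, A 3 2, A 5 4)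

/-- The standard symplectic form on `ℝ⁶`, whose matrix is `J₀ᵀ`. -/
def stdSymplectic (v w : Fin 6 → ℝ) : ℝ :=
  v 0 * w 1 - v 1 * w 0 + (v 2 * w 3 - v 3 * w 2) + (v 4 * w 5 - v 5 * w 4)

lemma stdSymplectic_add_left (v v' w : Fin 6 → ℝ) :
    stdSymplectic (v + v') w = stdSymplectic v w + stdSymplectic v' w := by
  simp only [stdSymplectic, Pi.add_apply]; ring

lemma stdSymplectic_add_right (v w w' : Fin 6 → ℝ) :
    stdSymplectic v (w + w') = stdSymplectic v w + stdSymplectic v w' := by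
  simp only [stdSymplectic, Pi.add_apply]; ring

lemma stdSymplectic_smul_left (c : ℝ) (v w : Fin 6 → ℝ) :
    stdSymplectic (c • v) w = c * stdSymplectic v w := by
  simp only [stdSymplectic, Pi.smul_apply, smul_eq_mul]; ring

lemma stdSymplectic_smul_right (c : ℝ) (v w : Fin 6 → ℝ) :
    stdSymplectic v (c • w) = c * stdSymplectic v w := by
  simp only [stdSymplectic, Pi.smul_apply, smul_eq_mul]; ring

lemma stdSymplectic_swap (v w : Fin 6 → ℝ) :
    stdSymplectic w v = -stdSymplectic v w := by
  simp only [stdSymplectic]; ring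

lemma stdSymplectic_self (v : Fin 6 → ℝ) : stdSymplectic v v = 0 := by
  simp only [stdSymplectic]; ring

/-- The Pfaffian of the `4 × 4` skew-symmetric matrix with entries `w i j` above the diagonal,
for the indices `a, b, c, d`. -/
def pfaffianFour (w : Fin 6 → Fin 6 → ℝ) (a b c d : Fin 6) : ℝ :=
  w a b * w c d - w a c * w b d + w a d * w b c

/-- The Pfaffian of a `6 × 6` skew-symmetric matrix, expanded along the first row. -/
def pfaffianSix (w : Fin 6 → Fin 6 → ℝ) : ℝ :=
  w 0 1 * pfaffianFour w 2 3 4 5 - w 0 2 * pfaffianFour w 1 3 4 5 +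
    w 0 3 * pfaffianFour w 1 2 4 5 - w 0 4 * pfaffianFour w 1 2 3 5 +
    w 0 5 * pfaffianFour w 1 2 3 4

lemma pfaffianSix_gram_update_add (v : Fin 6 → Fin 6 → ℝ) (i : Fin 6)
    (x y : Fin 6 → ℝ) :
    pfaffianSix (fun k l => stdSymplectic (Function.update v i (x + y) k)
        (Function.update v i (x + y) l)) =
      pfaffianSix (fun k l => stdSymplectic (Function.update v i x k) (Function.update v i x l)) +
        pfaffianSix (fun k l =>
          stdSymplectic (Function.update v i y k) (Function.update v i y l)) := by
  fin_cases i <;>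
    simp [pfaffianSix, pfaffianFour, stdSymplectic_add_left, stdSymplectic_add_right] <;> ring

lemma pfaffianSix_gram_update_smul (v : Fin 6 → Fin 6 → ℝ) (i : Fin 6)
    (c : ℝ) (x : Fin 6 → ℝ) :
    pfaffianSix (fun k l => stdSymplectic (Function.update v i (c • x) k)
        (Function.update v i (c • x) l)) =
      c * pfaffianSix (fun k l =>
        stdSymplectic (Function.update v i x k) (Function.update v i x l)) := by
  fin_cases i <;>
    simp [pfaffianSix, pfaffianFour, stdSymplectic_smul_left, stdSymplectic_smul_right] <;> ring

lemma pfaffianSix_gram_eq_zero_of_lt {v : Fin 6 → Fin 6 → ℝ} {i j : Fin 6} (h : v i = v j)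
    (hij : i < j) : pfaffianSix (fun k l => stdSymplectic (v k) (v l)) = 0 := by
  simp only [pfaffianSix, pfaffianFour]
  fin_cases i <;> fin_cases j <;> simp at hij <;> simp at h <;>
    simp only [h, stdSymplectic_self,
      stdSymplectic_swap (v 1) (v 2), stdSymplectic_swap (v 1) (v 3),
      stdSymplectic_swap (v 1) (v 4), stdSymplectic_swap (v 1) (v 5),
      stdSymplectic_swap (v 2) (v 3), stdSymplectic_swap (v 2) (v 4),
      stdSymplectic_swap (v 2) (v 5), stdSymplectic_swap (v 3) (v 4),
      stdSymplectic_swap (v 3) (v 5), stdSymplectic_swap (v 4) (v 5)] <;> ring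

/-- The Pfaffian of the Gram matrix of six vectors with respect to `stdSymplectic`,
as an alternating map. -/
def gramPfaffian : (Fin 6 → ℝ) [⋀^Fin 6]→ₗ[ℝ] ℝ where
  toFun v := pfaffianSix fun i j => stdSymplectic (v i) (v j)
  map_update_add' v i x y := by
    convert pfaffianSix_gram_update_add v i x y
  map_update_smul' v i c x := by
    rw [smul_eq_mul]
    convert pfaffianSix_gram_update_smul v i c x
  map_eq_zero_of_eq' v i j h hij := by
    rcases lt_or_gt_of_ne hij with hlt | hlt
    · exact pfaffianSix_gram_eq_zero_of_lt h hlt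
    · exact pfaffianSix_gram_eq_zero_of_lt h.symm hlt

lemma pfaffianSix_gram (P : Matrix (Fin 6) (Fin 6) ℝ) :
    pfaffianSix (fun i j => stdSymplectic (P i) (P j)) = P.det := by
  have h := gramPfaffian.eq_smul_basis_det (Pi.basisFun ℝ (Fin 6))
  have h1 : gramPfaffian (Pi.basisFun ℝ (Fin 6)) = 1 := by
    simp [gramPfaffian, pfaffianSix, pfaffianFour, stdSymplectic]
  rw [h1, one_smul] at h
  have h2 := DFunLike.congr_fun h P
  exact h2.trans (Pi.basisFun_det_apply P)

lemma conj_J₀_apply (P : Matrix (Fin 6) (Fin 6) ℝ) (i j : Fin 6) :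
    (P * J₀ * Pᵀ) i j = stdSymplectic (P j) (P i) := by
  simp [Matrix.mul_apply, Fin.sum_univ_six, J₀, E, stdSymplectic]
  ring

lemma J₀_mul_transpose : J₀ * J₀ᵀ = 1 := by
  ext i j
  fin_cases i <;> fin_cases j <;> simp [Matrix.mul_apply, J₀, E]

lemma sum_stdSymplectic_mul {P : Matrix (Fin 6) (Fin 6) ℝ} (hP : P * Pᵀ = 1) (i j : Fin 6) :
    ∑ k, stdSymplectic (P i) (P k) * stdSymplectic (P j) (P k) = if i = j then 1 else 0 := by
  have h : (P * J₀ * Pᵀ) * (P * J₀ * Pᵀ)ᵀ = 1 := by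
    have h' : Pᵀ * P = 1 := mul_eq_one_comm.mp hP
    calc _ = P * (J₀ * (Pᵀ * P) * J₀ᵀ) * Pᵀ := by
          simp only [transpose_mul, transpose_transpose, Matrix.mul_assoc]
      _ = 1 := by rw [h', Matrix.mul_one, J₀_mul_transpose, Matrix.mul_one, hP]
  have h2 := congrFun (congrFun h i) j
  rw [Matrix.mul_apply, Matrix.one_apply] at h2
  rw [← h2]
  refine Finset.sum_congr rfl fun k _ => ?_
  rw [transpose_apply, conj_J₀_apply, conj_J₀_apply, stdSymplectic_swap (P i),
    stdSymplectic_swap (P j), neg_mul_neg]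

lemma stdSymplectic_eq_pfaffianFour {P : Matrix (Fin 6) (Fin 6) ℝ} (hP : P * Pᵀ = 1)
    (hdet : P.det = 1) :
    stdSymplectic (P 0) (P 1) =
      pfaffianFour (fun i j => stdSymplectic (P i) (P j)) 2 3 4 5 := by
  have hpf := pfaffianSix_gram P
  have horth := sum_stdSymplectic_mul hP 1
  have h1 := horth 1
  have h2 := horth 2
  have h3 := horth 3
  have h4 := horth 4
  have h5 := horth 5
  rw [hdet] at hpf
  have hself i : stdSymplectic (P i) (P i) = 0 := stdSymplectic_self _
  simp only [Fin.sum_univ_six, hself, stdSymplectic_swap (P 0) (P 1),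
    stdSymplectic_swap (P 0) (P 2), stdSymplectic_swap (P 0) (P 3),
    stdSymplectic_swap (P 0) (P 4), stdSymplectic_swap (P 0) (P 5),
    stdSymplectic_swap (P 1) (P 2), stdSymplectic_swap (P 1) (P 3),
    stdSymplectic_swap (P 1) (P 4), stdSymplectic_swap (P 1) (P 5),
    stdSymplectic_swap (P 2) (P 3), stdSymplectic_swap (P 2) (P 4),
    stdSymplectic_swap (P 2) (P 5), stdSymplectic_swap (P 3) (P 4),
    stdSymplectic_swap (P 3) (P 5), stdSymplectic_swap (P 4) (P 5)] at h1 h2 h3 h4 h5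
  simp at h1 h2 h3 h4 h5
  set w : Fin 6 → Fin 6 → ℝ := fun i j => stdSymplectic (P i) (P j)
  have hw i j : stdSymplectic (P i) (P j) = w i j := rfl
  simp only [hw] at h1 h2 h3 h4 h5 ⊢
  simp only [pfaffianSix] at hpf
  linear_combination (norm := (simp only [pfaffianFour]; ring)) -w 0 1 * hpf +
    pfaffianFour w 2 3 4 5 * h1 - pfaffianFour w 1 3 4 5 * h2 +
    pfaffianFour w 1 2 4 5 * h3 - pfaffianFour w 1 2 3 5 * h4 +
    pfaffianFour w 1 2 3 4 * h5

lemma submatrix_perm_mul_transpose {P : Matrix (Fin 6) (Fin 6) ℝ} (hP : P * Pᵀ = 1)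
    (σ : Equiv.Perm (Fin 6)) : P.submatrix σ id * (P.submatrix σ id)ᵀ = 1 := by
  rw [transpose_submatrix, ← submatrix_mul P Pᵀ σ id σ Function.bijective_id, hP,
    submatrix_one_equiv]

lemma det_submatrix_perm {P : Matrix (Fin 6) (Fin 6) ℝ} (hdet : P.det = 1)
    {σ : Equiv.Perm (Fin 6)} (hσ : Equiv.Perm.sign σ = 1) : (P.submatrix σ id).det = 1 := by
  rw [det_permute, hσ, hdet]; simp

/-- With `s` the right-hand side, `4 * (1 + s)` equals `(1 + s) ^ 2` plus a sum of squares. -/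
lemma neg_one_le_sum_stdSymplectic {P : Matrix (Fin 6) (Fin 6) ℝ} (hP : P * Pᵀ = 1)
    (hdet : P.det = 1) :
    -1 ≤ stdSymplectic (P 0) (P 1) + stdSymplectic (P 2) (P 3) + stdSymplectic (P 4) (P 5) := by
  have hx := stdSymplectic_eq_pfaffianFour hP hdet
  have hy := stdSymplectic_eq_pfaffianFour
    (submatrix_perm_mul_transpose hP (Equiv.swap 0 2 * Equiv.swap 1 3))
    (det_submatrix_perm hdet (by decide))
  have hz := stdSymplectic_eq_pfaffianFour
    (submatrix_perm_mul_transpose hP (Equiv.swap 0 4 * Equiv.swap 1 5))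
    (det_submatrix_perm hdet (by decide))
  have e1 : ∀ i, P.submatrix (Equiv.swap 0 2 * Equiv.swap 1 3 : Equiv.Perm (Fin 6)) id i =
    P (![2, 3, 0, 1, 4, 5] i) := by
    intro i; fin_cases i <;> rfl
  have e2 : ∀ i, P.submatrix (Equiv.swap 0 4 * Equiv.swap 1 5 : Equiv.Perm (Fin 6)) id i =
    P (![4, 5, 2, 3, 0, 1] i) := by
    intro i; fin_cases i <;> rfl
  have horth i := sum_stdSymplectic_mul hP i i
  have h0 := horth 0
  have h1 := horth 1
  have h2 := horth 2
  have h3 := horth 3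
  have h4 := horth 4
  have h5 := horth 5
  have hself i : stdSymplectic (P i) (P i) = 0 := stdSymplectic_self _
  simp only [e1, e2, pfaffianFour, Matrix.cons_val] at hx hy hz
  simp only [Fin.sum_univ_six, if_true, hself, stdSymplectic_swap (P 0) (P 1),
    stdSymplectic_swap (P 0) (P 2), stdSymplectic_swap (P 0) (P 3),
    stdSymplectic_swap (P 0) (P 4), stdSymplectic_swap (P 0) (P 5),
    stdSymplectic_swap (P 1) (P 2), stdSymplectic_swap (P 1) (P 3),
    stdSymplectic_swap (P 1) (P 4), stdSymplectic_swap (P 1) (P 5),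
    stdSymplectic_swap (P 2) (P 3), stdSymplectic_swap (P 2) (P 4),
    stdSymplectic_swap (P 2) (P 5), stdSymplectic_swap (P 3) (P 4),
    stdSymplectic_swap (P 3) (P 5), stdSymplectic_swap (P 4) (P 5)]
    at h0 h1 h2 h3 h4 h5 hx hy hz
  generalize stdSymplectic (P 0) (P 1) = x at *
  generalize stdSymplectic (P 2) (P 3) = y at *
  generalize stdSymplectic (P 4) (P 5) = z at *
  generalize stdSymplectic (P 0) (P 2) = w02 at *
  generalize stdSymplectic (P 0) (P 3) = w03 at *
  generalize stdSymplectic (P 0) (P 4) = w04 at *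
  generalize stdSymplectic (P 0) (P 5) = w05 at *
  generalize stdSymplectic (P 1) (P 2) = w12 at *
  generalize stdSymplectic (P 1) (P 3) = w13 at *
  generalize stdSymplectic (P 1) (P 4) = w14 at *
  generalize stdSymplectic (P 1) (P 5) = w15 at *
  generalize stdSymplectic (P 2) (P 4) = w24 at *
  generalize stdSymplectic (P 2) (P 5) = w25 at *
  generalize stdSymplectic (P 3) (P 4) = w34 at *
  generalize stdSymplectic (P 3) (P 5) = w35 at *
  have key : 4 * (1 + x + y + z) = (1 + x + y + z) ^ 2 +
      (w02 - w13) ^ 2 + (w03 + w12) ^ 2 + (w04 - w15) ^ 2 + (w05 + w14) ^ 2 +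
      (w24 - w35) ^ 2 + (w25 + w34) ^ 2 := by
    linear_combination 2 * hx + 2 * hy + 2 * hz -
      (1 / 2) * h0 - (1 / 2) * h1 - (1 / 2) * h2 - (1 / 2) * h3 - (1 / 2) * h4 - (1 / 2) * h5
  have hnn : 0 ≤ 4 * (1 + x + y + z) := by rw [key]; positivity
  linarith

/-- The element of `SO(6)` acting as the identity on the span of `e₁, e₃, e₅` and as the rotation
attached to the quaternion `a + b i + c j + d k` on the span of `e₂, e₄, e₆`. -/
def quaternionRotation (a b c d : ℝ) : Matrix (Fin 6) (Fin 6) ℝ :=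
  !![1, 0, 0, 0, 0, 0;
     0, a ^ 2 + b ^ 2 - c ^ 2 - d ^ 2, 0, 2 * (b * c - a * d), 0, 2 * (b * d + a * c);
     0, 0, 1, 0, 0, 0;
     0, 2 * (b * c + a * d), 0, a ^ 2 - b ^ 2 + c ^ 2 - d ^ 2, 0, 2 * (c * d - a * b);
     0, 0, 0, 0, 1, 0;
     0, 2 * (b * d - a * c), 0, 2 * (c * d + a * b), 0, a ^ 2 - b ^ 2 - c ^ 2 + d ^ 2]

lemma quaternionRotation_mul_transpose {a b c d : ℝ} (h : a ^ 2 + b ^ 2 + c ^ 2 + d ^ 2 = 1) :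
    quaternionRotation a b c d * (quaternionRotation a b c d)ᵀ = 1 := by
  ext i j
  fin_cases i <;> fin_cases j <;>
    simp [quaternionRotation, Matrix.mul_apply, Fin.sum_univ_six] <;> first
    | (ring; done)
    | linear_combination (a ^ 2 + b ^ 2 + c ^ 2 + d ^ 2 + 1) * h

lemma det_quaternionRotation {a b c d : ℝ} (h : a ^ 2 + b ^ 2 + c ^ 2 + d ^ 2 = 1) :
    (quaternionRotation a b c d).det = 1 := by
  rw [← pfaffianSix_gram]
  simp [quaternionRotation, pfaffianSix, pfaffianFour, stdSymplectic]
  linear_combination ((a ^ 2 + b ^ 2 + c ^ 2 + d ^ 2) ^ 2 + (a ^ 2 + b ^ 2 + c ^ 2 + d ^ 2) + 1) * h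

lemma μ_conj_J₀ (P : Matrix (Fin 6) (Fin 6) ℝ) :
    μ (P * J₀ * Pᵀ) =
      (stdSymplectic (P 0) (P 1), stdSymplectic (P 2) (P 3), stdSymplectic (P 4) (P 5)) := by
  simp only [μ, conj_J₀_apply]

/-- The image under the toric moment map of the `SO(6)`-conjugation orbit of `J₀`
is the solid tetrahedron `Δ_{𝒫⁺}`. -/
theorem moment_image_orbit_J₀ :
    {p : ℝ × ℝ × ℝ | ∃ P : Matrix (Fin 6) (Fin 6) ℝ,
        P * Pᵀ = 1 ∧ P.det = 1 ∧ p = μ (P * J₀ * Pᵀ)} =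
    {p : ℝ × ℝ × ℝ |
        p.1 + p.2.1 + p.2.2 ≥ -1 ∧
        p.1 - p.2.1 - p.2.2 ≥ -1 ∧
        -p.1 + p.2.1 - p.2.2 ≥ -1 ∧
        -p.1 - p.2.1 + p.2.2 ≥ -1} := by
  ext ⟨x, y, z⟩
  simp only [Set.mem_ofPred_eq, μ_conj_J₀, Prod.mk.injEq, ge_iff_le]
  constructor
  · rintro ⟨P, hP, hdet, rfl, rfl, rfl⟩
    have key (σ : Equiv.Perm (Fin 6)) (hσ : Equiv.Perm.sign σ = 1) (s : Fin 6 → Fin 6)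
        (hs : σ = s) :
        -1 ≤ stdSymplectic (P (s 0)) (P (s 1)) + stdSymplectic (P (s 2)) (P (s 3)) +
          stdSymplectic (P (s 4)) (P (s 5)) := by
      subst hs
      exact neg_one_le_sum_stdSymplectic (submatrix_perm_mul_transpose hP σ)
        (det_submatrix_perm hdet hσ)
    have h1 := key (Equiv.swap 2 3 * Equiv.swap 4 5) (by decide) ![0, 1, 3, 2, 5, 4] (by decide)
    have h2 := key (Equiv.swap 0 1 * Equiv.swap 4 5) (by decide) ![1, 0, 2, 3, 5, 4] (by decide)
    have h3 := key (Equiv.swap 0 1 * Equiv.swap 2 3) (by decide) ![1, 0, 3, 2, 4, 5] (by decide)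
    simp only [Matrix.cons_val] at h1 h2 h3
    rw [stdSymplectic_swap (P 2), stdSymplectic_swap (P 4)] at h1
    rw [stdSymplectic_swap (P 0), stdSymplectic_swap (P 4)] at h2
    rw [stdSymplectic_swap (P 0), stdSymplectic_swap (P 2)] at h3
    exact ⟨neg_one_le_sum_stdSymplectic hP hdet, by linarith, by linarith, by linarith⟩
  · rintro ⟨h0, h1, h2, h3⟩
    have ha := Real.sq_sqrt (show 0 ≤ (1 + x + y + z) / 4 by linarith)
    have hb := Real.sq_sqrt (show 0 ≤ (1 + x - y - z) / 4 by linarith)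
    have hc := Real.sq_sqrt (show 0 ≤ (1 - x + y - z) / 4 by linarith)
    have hd := Real.sq_sqrt (show 0 ≤ (1 - x - y + z) / 4 by linarith)
    have hsum : √((1 + x + y + z) / 4) ^ 2 + √((1 + x - y - z) / 4) ^ 2 +
        √((1 - x + y - z) / 4) ^ 2 + √((1 - x - y + z) / 4) ^ 2 = 1 := by
      linarith
    refine ⟨_, quaternionRotation_mul_transpose hsum, det_quaternionRotation hsum, ?_, ?_, ?_⟩ <;>
      simp only [quaternionRotation, stdSymplectic, of_apply, Matrix.cons_val] <;>
      rw [ha, hb, hc, hd] <;> ring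
end
end

section
/- For any λ₁, λ₂, λ₃ ∈ ℝ let D = λ₁E₁₂ + λ₂E₃₄ + λ₃E₅₆. Then the image of the SO(6)-conjugation orbit of D under the toric moment map is the convex hull of the Weyl group orbit of (λ₁,λ₂,λ₃): {μ(P D Pᵀ) : P ∈ SO(6)} = convexHull{(ε₁λ_{σ(1)}, ε₂λ_{σ(2)}, ε₃λ_{σ(3)}) : σ a permutation of {1,2,3}, ε₁, ε₂, ε₃ ∈ {−1,1}, ε₁ε₂ε₃ = 1}. (This is the Atiyah–Guillemin–Sternberg convexity theorem for the coadjoint orbits of SO(6): every Riemannian structure on ℝ⁶ defined by a 2-form has a characteristic moment polytope.) -/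
open Matrix

noncomputable section

/-- The Pfaffian of the `6 × 6` skew-symmetric matrix with lower triangle `b`. -/
def pfaffian (b : Matrix (Fin 6) (Fin 6) ℝ) : ℝ :=
  b 1 0 * (b 3 2 * b 5 4 - b 4 2 * b 5 3 + b 5 2 * b 4 3) -
  b 2 0 * (b 3 1 * b 5 4 - b 4 1 * b 5 3 + b 5 1 * b 4 3) +
  b 3 0 * (b 2 1 * b 5 4 - b 4 1 * b 5 2 + b 5 1 * b 4 2) -
  b 4 0 * (b 2 1 * b 5 3 - b 3 1 * b 5 2 + b 5 1 * b 3 2) +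
  b 5 0 * (b 2 1 * b 4 3 - b 3 1 * b 4 2 + b 4 1 * b 3 2)

lemma pfaffian_eq_zero_of_row_eq {b : Matrix (Fin 6) (Fin 6) ℝ} (hb : ∀ i j, b i j = -b j i)
    {i j : Fin 6} (hij : i ≠ j) (h : ∀ k, b i k = b j k) : pfaffian b = 0 := by
  wlog hlt : i < j generalizing i j
  · exact this hij.symm (fun k => (h k).symm) (lt_of_le_of_ne (not_lt.mp hlt) hij.symm)
  have hd : ∀ i, b i i = 0 := fun i => by linarith [hb i i]
  have h' : ∀ k, b k i = b k j := fun k => by rw [hb k i, hb k j, h]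
  have r0 := h 0
  have r1 := h 1
  have r2 := h 2
  have r3 := h 3
  have c1 := h' 1
  have c2 := h' 2
  have c3 := h' 3
  have c4 := h' 4
  have c5 := h' 5
  clear h h'
  unfold pfaffian
  fin_cases i <;> fin_cases j <;> first | (exfalso; revert hlt; decide) | skip
  all_goals
    simp only [Fin.zero_eta, Fin.mk_one, Fin.reduceFinMk] at *
    simp only [r0, r1, r2, r3, c1, c2, c3, c4, c5, hd, hb 1 2, hb 1 3, hb 1 4, hb 1 5, hb 2 3, hb 2 4, hb 2 5, hb 3 4, hb 3 5, hb 4 5]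
    ring

/-- The Pfaffian of the Gram matrix of a skew form, as an alternating map. -/
def pfaffianForm (B : (Fin 6 → ℝ) →ₗ[ℝ] (Fin 6 → ℝ) →ₗ[ℝ] ℝ) (hB : ∀ x y, B x y = -B y x) :
    (Fin 6 → ℝ) [⋀^Fin 6]→ₗ[ℝ] ℝ where
  toFun v := pfaffian (Matrix.of fun i j => B (v i) (v j))
  map_update_add' {inst} m i x y := by
    obtain rfl : inst = instDecidableEqFin 6 := Subsingleton.elim _ _
    fin_cases i <;>
    · simp [pfaffian, Function.update, -neg_add_rev]
      ring
  map_update_smul' {inst} m i c x := by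
    obtain rfl : inst = instDecidableEqFin 6 := Subsingleton.elim _ _
    fin_cases i <;>
    · simp [pfaffian, Function.update]
      ring
  map_eq_zero_of_eq' v i j h hij :=
    pfaffian_eq_zero_of_row_eq (fun i j => hB _ _) hij fun k => by simp [h]

lemma pfaffian_conj (P K : Matrix (Fin 6) (Fin 6) ℝ) (hK : Kᵀ = -K) :
    pfaffian (P * K * Pᵀ) = P.det * pfaffian K := by
  let B : (Fin 6 → ℝ) →ₗ[ℝ] (Fin 6 → ℝ) →ₗ[ℝ] ℝ := Matrix.toLinearMap₂' ℝ K
  have hB : ∀ x y, B x y = -B y x := by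
    intro x y
    simp only [B]
    rw [Matrix.toLinearMap₂'_apply', Matrix.toLinearMap₂'_apply', Matrix.dotProduct_mulVec,
      ← Matrix.mulVec_transpose, hK, Matrix.neg_mulVec, neg_dotProduct, dotProduct_comm]
  have h := congrArg (fun f : (Fin 6 → ℝ) [⋀^Fin 6]→ₗ[ℝ] ℝ => f P.row) (AlternatingMap.eq_smul_basis_det
    (Pi.basisFun ℝ (Fin 6)) (pfaffianForm B hB))
  rw [Pi.basisFun_det, AlternatingMap.smul_apply, smul_eq_mul, mul_comm] at h
  convert h using 2
  · change _ = pfaffian _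
    congr 1
    ext i j
    simp only [B, Matrix.of_apply]
    rw [Matrix.toLinearMap₂'_apply', Matrix.mul_assoc, Matrix.mul_apply]
    simp [dotProduct, Matrix.mulVec, Matrix.mul_apply]
  · exact congrArg Matrix.det (rfl : P = Matrix.of P.row)
  · change _ = pfaffian _
    congr 1
    ext i j
    simp [B, Matrix.toLinearMap₂'_apply']

/-- The four weights of the half-spin representation of `SO(6)`, doubled. -/
def spinWeight : Fin 4 → Fin 3 → ℤ := ![![1, 1, 1], ![1, -1, -1], ![-1, 1, -1], ![-1, -1, 1]]

lemma nonneg_of_mul_nonneg {p q r s : ℝ} (h : 0 < p + q + r + s)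
    (hq : 0 ≤ p * q) (hr : 0 ≤ p * r) (hs : 0 ≤ p * s) : 0 ≤ p := by
  by_contra! hp
  have := nonpos_of_mul_nonneg_right hq hp
  have := nonpos_of_mul_nonneg_right hr hp
  have := nonpos_of_mul_nonneg_right hs hp
  linarith

lemma spin_nonneg {A : Matrix (Fin 6) (Fin 6) ℝ} (hA : Aᵀ = -A) (hA2 : A * A = -1)
    (hpf : pfaffian A = 1) (a : Fin 4) :
    0 ≤ 1 + (spinWeight a 0 * A 1 0 + spinWeight a 1 * A 3 2 + spinWeight a 2 * A 5 4) := by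
  have hs : ∀ i j, A i j = -A j i := fun i j => by
    have := congrFun (congrFun hA j) i
    simpa using this
  have hd : ∀ i, A i i = 0 := fun i => by linarith [hs i i]
  have hm : ∀ i j, A i 0 * A 0 j + A i 1 * A 1 j + A i 2 * A 2 j + A i 3 * A 3 j + A i 4 * A 4 j
      + A i 5 * A 5 j = if i = j then -1 else 0 := fun i j => by
    have := congrFun (congrFun hA2 i) j
    rw [Matrix.mul_apply, Fin.sum_univ_six] at this
    rw [this, Matrix.neg_apply, Matrix.one_apply]
    split_ifs <;> simp
  have key : ∀ i j, i ≠ j → A i 0 * A 0 j + A i 1 * A 1 j + A i 2 * A 2 j + A i 3 * A 3 j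
      + A i 4 * A 4 j + A i 5 * A 5 j = 0 := fun i j h => by rw [hm, if_neg h]
  have key' : ∀ i, A i 0 * A 0 i + A i 1 * A 1 i + A i 2 * A 2 i + A i 3 * A 3 i
      + A i 4 * A 4 i + A i 5 * A 5 i = -1 := fun i => by rw [hm, if_pos rfl]
  have e00 := key' 0
  have e11 := key' 1
  have e22 := key' 2
  have e33 := key' 3
  have e44 := key' 4
  have e55 := key' 5
  have e12 := key 1 2 (by decide)
  have e13 := key 1 3 (by decide)
  have e14 := key 1 4 (by decide)
  have e15 := key 1 5 (by decide)
  have e30 := key 3 0 (by decide)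
  have e31 := key 3 1 (by decide)
  have e34 := key 3 4 (by decide)
  have e35 := key 3 5 (by decide)
  have e50 := key 5 0 (by decide)
  have e51 := key 5 1 (by decide)
  have e52 := key 5 2 (by decide)
  have e53 := key 5 3 (by decide)
  clear hm key key' hA hA2
  unfold pfaffian at hpf
  simp only [hd, hs 0 1, hs 0 2, hs 0 3, hs 0 4,
      hs 0 5, hs 1 2, hs 1 3, hs 1 4, hs 1 5, hs 2 3, hs 2 4, hs 2 5, hs 3 4, hs 3 5, hs 4 5] at *
  clear hs hd
  generalize A 1 0 = a01 at *
  generalize A 2 0 = a02 at *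
  generalize A 3 0 = a03 at *
  generalize A 4 0 = a04 at *
  generalize A 5 0 = a05 at *
  generalize A 2 1 = a12 at *
  generalize A 3 1 = a13 at *
  generalize A 4 1 = a14 at *
  generalize A 5 1 = a15 at *
  generalize A 3 2 = a23 at *
  generalize A 4 2 = a24 at *
  generalize A 5 2 = a25 at *
  generalize A 4 3 = a34 at *
  generalize A 5 3 = a35 at *
  generalize A 5 4 = a45 at *
  have hx : a01 = a23 * a45 - a24 * a35 + a25 * a34 := by
    linear_combination -a01 * hpf - (a23 * a45 - a24 * a35 + a25 * a34) * e11
      + (a13 * a45 - a14 * a35 + a15 * a34) * e12 - (a12 * a45 - a14 * a25 + a15 * a24) * e13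
      + (a12 * a35 - a13 * a25 + a15 * a23) * e14 - (a12 * a34 - a13 * a24 + a14 * a23) * e15
  have hy : a23 = a01 * a45 - a04 * a15 + a05 * a14 := by
    linear_combination -a23 * hpf - (a13 * a45 - a14 * a35 + a15 * a34) * e30
      + (a03 * a45 - a04 * a35 + a05 * a34) * e31 - (a01 * a45 - a04 * a15 + a05 * a14) * e33
      + (a01 * a35 - a03 * a15 + a05 * a13) * e34 - (a01 * a34 - a03 * a14 + a04 * a13) * e35
  have hz : a45 = a01 * a23 - a02 * a13 + a03 * a12 := by
    linear_combination -a45 * hpf - (a12 * a35 - a13 * a25 + a15 * a23) * e50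
      + (a02 * a35 - a03 * a25 + a05 * a23) * e51 - (a01 * a35 - a03 * a15 + a05 * a13) * e52
      + (a01 * a25 - a02 * a15 + a05 * a12) * e53 - (a01 * a23 - a02 * a13 + a03 * a12) * e55
  have h01 : (1 + a01 + a23 + a45) * (1 + a01 - a23 - a45) = (a24 - a35) ^ 2 + (a25 + a34) ^ 2 := by
    linear_combination 2 * hx - (e00 + e11 - e22 - e33 - e44 - e55) / 2
  have h02 : (1 + a01 + a23 + a45) * (1 - a01 + a23 - a45) = (a04 - a15) ^ 2 + (a05 + a14) ^ 2 := by
    linear_combination 2 * hy - (e22 + e33 - e00 - e11 - e44 - e55) / 2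
  have h03 : (1 + a01 + a23 + a45) * (1 - a01 - a23 + a45) = (a02 - a13) ^ 2 + (a03 + a12) ^ 2 := by
    linear_combination 2 * hz - (e44 + e55 - e00 - e11 - e22 - e33) / 2
  have h12 : (1 + a01 - a23 - a45) * (1 - a01 + a23 - a45) = (a02 + a13) ^ 2 + (a03 - a12) ^ 2 := by
    linear_combination -2 * hz - (e44 + e55 - e00 - e11 - e22 - e33) / 2
  have h13 : (1 + a01 - a23 - a45) * (1 - a01 - a23 + a45) = (a04 + a15) ^ 2 + (a05 - a14) ^ 2 := by
    linear_combination -2 * hy - (e22 + e33 - e00 - e11 - e44 - e55) / 2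
  have h23 : (1 - a01 + a23 - a45) * (1 - a01 - a23 + a45) = (a24 + a35) ^ 2 + (a25 - a34) ^ 2 := by
    linear_combination -2 * hx - (e00 + e11 - e22 - e33 - e44 - e55) / 2
  have g01 := h01.ge.trans' (by positivity)
  have g02 := h02.ge.trans' (by positivity)
  have g03 := h03.ge.trans' (by positivity)
  have g12 := h12.ge.trans' (by positivity)
  have g13 := h13.ge.trans' (by positivity)
  have g23 := h23.ge.trans' (by positivity)
  have p0 := nonneg_of_mul_nonneg (by linarith) g01 g02 g03
  rw [mul_comm] at g01 g02 g03
  have p1 := nonneg_of_mul_nonneg (by linarith) g01 g12 g13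
  rw [mul_comm] at g12 g13
  have p2 := nonneg_of_mul_nonneg (by linarith) g02 g12 g23
  rw [mul_comm] at g23
  have p3 := nonneg_of_mul_nonneg (by linarith) g03 g13 g23
  fin_cases a <;> simp [spinWeight] <;> linarith

/-- The Weyl group orbit of `l`: permutations and even sign changes. -/
def weylOrbit (l : Fin 3 → ℝ) : Set (ℝ × ℝ × ℝ) :=
  {p | ∃ (σ : Equiv.Perm (Fin 3)) (ε : Fin 3 → ℝ),
        (∀ i, ε i = 1 ∨ ε i = -1) ∧ ε 0 * ε 1 * ε 2 = 1 ∧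
        p = (ε 0 * l (σ 0), ε 1 * l (σ 1), ε 2 * l (σ 2))}

lemma exists_perm_spinWeight : ∀ (σ : Equiv.Perm (Fin 3)) (ε : Fin 3 → ℤˣ), ε 0 * ε 1 * ε 2 = 1 →
    ∃ π : Equiv.Perm (Fin 4), ∀ a i, spinWeight (π a) (σ i) = ε i * spinWeight a i := by
  decide +kernel

lemma exists_signedPerm_spinWeight : ∀ π : Equiv.Perm (Fin 4), ∃ (σ : Equiv.Perm (Fin 3))
    (ε : Fin 3 → ℤˣ), ε 0 * ε 1 * ε 2 = 1 ∧
      ∀ a i, spinWeight (π a) (σ i) = ε i * spinWeight a i := by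
  decide +kernel

lemma mulVec_mem_convexHull_weylOrbit (l : Fin 3 → ℝ) (M : Matrix (Fin 3) (Fin 3) ℝ)
    (hM : ∀ a b, 0 ≤ 1 + ∑ i, ∑ j, (spinWeight a i : ℝ) * M i j * spinWeight b j) :
    ((M *ᵥ l) 0, (M *ᵥ l) 1, (M *ᵥ l) 2) ∈ convexHull ℝ (weylOrbit l) := by
  let S : Matrix (Fin 4) (Fin 4) ℝ :=
    Matrix.of fun a b => (1 + ∑ i, ∑ j, (spinWeight a i : ℝ) * M i j * spinWeight b j) / 4
  have hS : S ∈ doublyStochastic ℝ (Fin 4) := by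
    rw [mem_doublyStochastic_iff_sum]
    refine ⟨fun a b => div_nonneg (hM a b) (by norm_num), fun a => ?_, fun b => ?_⟩
    · simp [S, Fin.sum_univ_four, Fin.sum_univ_three, spinWeight]
      ring
    · simp [S, Fin.sum_univ_four, Fin.sum_univ_three, spinWeight]
      ring
  obtain ⟨w, hw0, hw1, hwS⟩ := exists_eq_sum_perm_of_mem_doublyStochastic hS
  let c : Fin 4 → ℝ := fun a => ∑ j, (spinWeight a j : ℝ) * l j
  let p : Equiv.Perm (Fin 4) → Fin 3 → ℝ := fun π i => (∑ a, (spinWeight a i : ℝ) * c (π a)) / 4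
  have hp : ∀ π, (p π 0, p π 1, p π 2) ∈ weylOrbit l := by
    intro π
    obtain ⟨σ, ε, hε, h⟩ := exists_signedPerm_spinWeight π
    have h' : ∀ i, p π i = ((ε i : ℤ) : ℝ) * l (σ i) := by
      have hc : ∀ a, c (π a) = ∑ i, ((ε i : ℤ) : ℝ) * spinWeight a i * l (σ i) := fun a => by
        simp only [c, ← Equiv.sum_comp σ (fun j => (spinWeight (π a) j : ℝ) * l j), h, Int.cast_mul]
      intro i
      simp only [p, hc]
      fin_cases i <;> simp [Fin.sum_univ_four, Fin.sum_univ_three, spinWeight] <;> ring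
    refine ⟨σ, fun i => ((ε i : ℤ) : ℝ), fun i => ?_, ?_, by simp only [h']⟩
    · rcases Int.units_eq_one_or (ε i) with h | h <;> simp [h]
    · simpa using congrArg (fun u : ℤˣ => ((u : ℤ) : ℝ)) hε
  have hsum : ∀ i, (M *ᵥ l) i = ∑ π, w π * p π i := by
    have hSc : ∀ a, (S *ᵥ c) a = ∑ π, w π * c (π a) := fun a => by
      rw [← hwS, Matrix.sum_mulVec, Finset.sum_apply]
      simp [Matrix.smul_mulVec, Matrix.permMatrix_mulVec]
    have h1 : ∀ i, ∑ π, w π * p π i = (∑ a, (spinWeight a i : ℝ) * (S *ᵥ c) a) / 4 := fun i => by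
      simp only [hSc, p, Finset.mul_sum, Finset.sum_div]
      rw [Finset.sum_comm]
      exact Finset.sum_congr rfl fun _ _ => Finset.sum_congr rfl fun _ _ => by ring
    intro i
    rw [h1]
    fin_cases i <;> simp [S, c, Matrix.mulVec, dotProduct, Fin.sum_univ_four, Fin.sum_univ_three,
      spinWeight] <;> ring
  have := (convex_convexHull ℝ (weylOrbit l)).sum_mem (t := Finset.univ) (fun π _ => hw0 π) hw1
    fun π _ => subset_convexHull ℝ _ (hp π)
  convert this using 1
  ext <;> simp [hsum, Prod.fst_sum, Prod.snd_sum]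

/-- The weights of the half-spin representation, as a linear map on the Cartan subalgebra. -/
def spinCoord : (ℝ × ℝ × ℝ) →ₗ[ℝ] (Fin 4 → ℝ) where
  toFun p a := spinWeight a 0 * p.1 + spinWeight a 1 * p.2.1 + spinWeight a 2 * p.2.2
  map_add' p q := by
    ext a
    simp
    ring
  map_smul' r p := by
    ext a
    simp
    ring

lemma spinCoord_injective : Function.Injective spinCoord := by
  intro p q h
  have h0 := congrFun h 0
  have h1 := congrFun h 1
  have h2 := congrFun h 2
  simp [spinCoord, spinWeight] at h0 h1 h2
  ext <;> linarith

lemma exists_perm_spinCoord {l : Fin 3 → ℝ} {p : ℝ × ℝ × ℝ} (hp : p ∈ weylOrbit l) :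
    ∃ π : Equiv.Perm (Fin 4), spinCoord p = spinCoord (l 0, l 1, l 2) ∘ π := by
  obtain ⟨σ, ε, hε, hprod, rfl⟩ := hp
  have : ∀ i, ∃ u : ℤˣ, ((u : ℤ) : ℝ) = ε i := fun i => by
    rcases hε i with h | h
    · exact ⟨1, by simp [h]⟩
    · exact ⟨-1, by simp [h]⟩
  choose u hu using this
  obtain ⟨π, h⟩ := exists_perm_spinWeight σ u (by
    rw [← hu, ← hu, ← hu] at hprod
    refine Units.ext (Int.cast_injective (α := ℝ) ?_)
    simpa using hprod)
  refine ⟨π, funext fun a => ?_⟩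
  have h1 := Equiv.sum_comp σ (fun j => (spinWeight (π a) j : ℝ) * l j)
  simp only [h, Int.cast_mul, hu, Fin.sum_univ_three] at h1
  simp only [spinCoord, LinearMap.coe_mk, AddHom.coe_mk, Function.comp]
  linarith

section Majorization

variable {Q : (Fin 4 → ℝ) → Prop}

lemma comp_perm_of_comp_adjacent_swap
    (hQ : ∀ v, Q v → ∀ i : Fin 3, Q (v ∘ Equiv.swap i.castSucc i.succ))
    (π : Equiv.Perm (Fin 4)) {v : Fin 4 → ℝ} (hv : Q v) : Q (v ∘ π) := by
  have hπ : π ∈ Submonoid.closure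
      (Set.range fun i : Fin 3 => Equiv.swap i.castSucc i.succ) := by
    rw [Equiv.Perm.mclosure_swap_castSucc_succ]
    trivial
  induction hπ using Submonoid.closure_induction generalizing v with
  | mem x hx =>
    obtain ⟨i, rfl⟩ := hx
    exact hQ v hv i
  | one => simpa using hv
  | mul x y _ _ hx hy => exact hy (hx hv)

lemma eq_vecCons (w : Fin 4 → ℝ) : w = ![w 0, w 1, w 2, w 3] := by
  ext i
  fin_cases i <;> rfl

lemma swap_of_mix
    (h12 : ∀ a b c d s, Q ![a, b, c, d] → s ∈ Set.uIcc a b → Q ![s, a + b - s, c, d])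
    (h23 : ∀ a b c d s, Q ![a, b, c, d] → s ∈ Set.uIcc b c → Q ![a, s, b + c - s, d])
    (h34 : ∀ a b c d s, Q ![a, b, c, d] → s ∈ Set.uIcc c d → Q ![a, b, s, c + d - s])
    (v : Fin 4 → ℝ) (hv : Q v) (i : Fin 3) : Q (v ∘ Equiv.swap i.castSucc i.succ) := by
  rw [eq_vecCons v] at hv
  fin_cases i
  · convert h12 _ _ _ _ _ hv Set.right_mem_uIcc using 1
    ext j
    fin_cases j <;> simp [Equiv.swap_apply_def]
  · convert h23 _ _ _ _ _ hv Set.right_mem_uIcc using 1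
    ext j
    fin_cases j <;> simp [Equiv.swap_apply_def]
  · convert h34 _ _ _ _ _ hv Set.right_mem_uIcc using 1
    ext j
    fin_cases j <;> simp [Equiv.swap_apply_def]

lemma of_majorized_three (h23 : ∀ a b c d s, Q ![a, b, c, d] → s ∈ Set.uIcc b c → Q ![a, s, b + c - s, d])
    (h34 : ∀ a b c d s, Q ![a, b, c, d] → s ∈ Set.uIcc c d → Q ![a, b, s, c + d - s])
    {x a b c r s t : ℝ} (h : Q ![x, a, b, c]) (hab : b ≤ a) (hrs : s ≤ r)
    (hst : t ≤ s) (hr : r ≤ a) (ht : c ≤ t) (hsum : r + s + t = a + b + c) :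
    Q ![x, r, s, t] := by
  have s34 : ∀ {a b c d}, Q ![a, b, c, d] → Q ![a, b, d, c] := fun h => by
    simpa using h34 _ _ _ _ _ h Set.right_mem_uIcc
  rcases le_or_gt b r with hbr | hbr
  · have h1 := h34 _ _ _ _ s (h23 _ _ _ _ r h (Set.mem_uIcc.2 (Or.inr ⟨hbr, hr⟩)))
      (Set.mem_uIcc.2 (Or.inr ⟨by linarith, by linarith⟩))
    rwa [show a + b - r + c - s = t by linarith] at h1
  · have h1 := h34 _ _ _ _ s (s34 (h23 _ _ _ _ r (s34 h) (Set.mem_uIcc.2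
      (Or.inr ⟨by linarith, hr⟩)))) (Set.mem_uIcc.2 (Or.inr ⟨by linarith, by linarith⟩))
    rwa [show b + (a + c - r) - s = t by linarith] at h1

lemma of_majorized_four
    (h12 : ∀ a b c d s, Q ![a, b, c, d] → s ∈ Set.uIcc a b → Q ![s, a + b - s, c, d])
    (h23 : ∀ a b c d s, Q ![a, b, c, d] → s ∈ Set.uIcc b c → Q ![a, s, b + c - s, d])
    (h34 : ∀ a b c d s, Q ![a, b, c, d] → s ∈ Set.uIcc c d → Q ![a, b, s, c + d - s])
    {a b c d q r s t : ℝ} (h : Q ![a, b, c, d]) (hab : b ≤ a) (hbc : c ≤ b)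
    (hqr : r ≤ q) (hrs : s ≤ r) (hst : t ≤ s) (hq : q ≤ a) (ht : d ≤ t) (hqr' : q + r ≤ a + b)
    (hsum : q + r + s + t = a + b + c + d) :
    Q ![q, r, s, t] := by
  have s23 : ∀ {a b c d}, Q ![a, b, c, d] → Q ![a, c, b, d] := fun h => by
    simpa using h23 _ _ _ _ _ h Set.right_mem_uIcc
  have s34 : ∀ {a b c d}, Q ![a, b, c, d] → Q ![a, b, d, c] := fun h => by
    simpa using h34 _ _ _ _ _ h Set.right_mem_uIcc
  rcases le_or_gt b q with hb | hb
  · exact of_majorized_three h23 h34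
      (h12 _ _ _ _ q h (Set.mem_uIcc.2 (Or.inr ⟨hb, hq⟩)))
      (by linarith) hrs hst (by linarith) ht (by linarith)
  rcases le_or_gt c q with hc | hc
  · have h1 := h12 _ _ _ _ q (s23 h) (Set.mem_uIcc.2 (Or.inr ⟨hc, hq⟩))
    rcases le_total (a + c - q) b with hb' | hb'
    · exact of_majorized_three h23 h34 (s23 h1) hb' hrs hst (by linarith) ht
        (by linarith)
    · exact of_majorized_three h23 h34 h1 hb' hrs hst (by linarith) ht (by linarith)
  · have h1 := h12 _ _ _ _ q (s23 (s34 h)) (Set.mem_uIcc.2 (Or.inr ⟨by linarith, hq⟩))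
    exact of_majorized_three h23 h34 (s34 (s23 h1)) hbc hrs hst (by linarith)
      (by linarith) (by linarith)

lemma of_majorized
    (h12 : ∀ a b c d s, Q ![a, b, c, d] → s ∈ Set.uIcc a b → Q ![s, a + b - s, c, d])
    (h23 : ∀ a b c d s, Q ![a, b, c, d] → s ∈ Set.uIcc b c → Q ![a, s, b + c - s, d])
    (h34 : ∀ a b c d s, Q ![a, b, c, d] → s ∈ Set.uIcc c d → Q ![a, b, s, c + d - s])
    {u v : Fin 4 → ℝ} (hu : Q u) (hu' : Antitone u)
    (hmax : ∀ i, v i ≤ u 0) (hmin : ∀ i, u 3 ≤ v i) (hpair : ∀ i j, i ≠ j → v i + v j ≤ u 0 + u 1)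
    (hsum : ∑ i, v i = ∑ i, u i) : Q v := by
  let τ := Tuple.sort (fun i => -v i)
  have hτ : Antitone (v ∘ τ) := fun i j hij => by
    simpa using Tuple.monotone_sort (fun i => -v i) hij
  have hsum' : ∑ i, v (τ i) = ∑ i, u i := by rw [Equiv.sum_comp τ v, hsum]
  rw [Fin.sum_univ_four, Fin.sum_univ_four] at hsum'
  rw [eq_vecCons u] at hu
  have key := of_majorized_four h12 h23 h34 hu (hu' (by decide)) (hu' (by decide))
    (hτ (by decide : (0 : Fin 4) ≤ 1)) (hτ (by decide : (1 : Fin 4) ≤ 2))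
    (hτ (by decide : (2 : Fin 4) ≤ 3)) (hmax _) (hmin _) (hpair _ _ (by simp)) hsum'
  simp only [Function.comp] at key
  have h1 := comp_perm_of_comp_adjacent_swap (swap_of_mix h12 h23 h34) τ⁻¹ key
  convert h1 using 1
  rw [← eq_vecCons (fun i => v (τ i))]
  ext i
  simp

end Majorization

/-- The image of the `SO(6)`-conjugation orbit of `D` under the toric moment map. -/
def momentImage (D : Matrix (Fin 6) (Fin 6) ℝ) : Set (ℝ × ℝ × ℝ) :=
  {p | ∃ P : Matrix (Fin 6) (Fin 6) ℝ, P * Pᵀ = 1 ∧ P.det = 1 ∧ p = μ (P * D * Pᵀ)}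

lemma det_eq_one_of_sq {G H : Matrix (Fin 6) (Fin 6) ℝ} (hH : H * Hᵀ = 1) (h : G = H * H) :
    G.det = 1 := by
  have := congrArg Matrix.det hH
  rwa [Matrix.det_mul, Matrix.det_transpose, Matrix.det_one, ← Matrix.det_mul, ← h] at this

lemma moment_conj_mem_momentImage {D A P : Matrix (Fin 6) (Fin 6) ℝ}
    (hP : P * Pᵀ = 1) (hdet : P.det = 1) (hA : A = P * D * Pᵀ)
    (G : ℝ → Matrix (Fin 6) (Fin 6) ℝ) (hG : ∀ θ, G θ * (G θ)ᵀ = 1)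
    (hG2 : ∀ θ, G (2 * θ) = G θ * G θ) (θ : ℝ) : μ (G θ * A * (G θ)ᵀ) ∈ momentImage D := by
  refine ⟨G θ * P, ?_, ?_, ?_⟩
  · rw [Matrix.transpose_mul, Matrix.mul_assoc, ← Matrix.mul_assoc P, hP, Matrix.one_mul, hG]
  · rw [Matrix.det_mul, hdet, mul_one]
    exact det_eq_one_of_sq (hG (θ / 2)) (by rw [← hG2]; ring_nf)
  · rw [hA, Matrix.transpose_mul]
    simp only [Matrix.mul_assoc]

lemma exists_quadratic_eq {x y k s : ℝ} (hs : s ∈ Set.uIcc x y) :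
    ∃ θ : ℝ, x * Real.cos θ ^ 2 + y * Real.sin θ ^ 2 + k * (Real.cos θ * Real.sin θ) = s := by
  have hcont : ContinuousOn (fun θ : ℝ => x * Real.cos θ ^ 2 + y * Real.sin θ ^ 2 +
      k * (Real.cos θ * Real.sin θ)) (Set.uIcc 0 (Real.pi / 2)) := by fun_prop
  obtain ⟨θ, -, h⟩ := intermediate_value_uIcc hcont (by simpa using hs)
  exact ⟨θ, h⟩

/-- Simultaneous rotation of the first two coordinate planes. -/
def rotFirst (θ : ℝ) : Matrix (Fin 6) (Fin 6) ℝ :=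
  !![Real.cos θ, 0, Real.sin θ, 0, 0, 0;
    0, Real.cos θ, 0, Real.sin θ, 0, 0;
    -Real.sin θ, 0, Real.cos θ, 0, 0, 0;
    0, -Real.sin θ, 0, Real.cos θ, 0, 0;
    0, 0, 0, 0, 1, 0;
    0, 0, 0, 0, 0, 1]

/-- Simultaneous rotation of the last two coordinate planes. -/
def rotLast (θ : ℝ) : Matrix (Fin 6) (Fin 6) ℝ :=
  !![1, 0, 0, 0, 0, 0;
    0, 1, 0, 0, 0, 0;
    0, 0, Real.cos θ, 0, Real.sin θ, 0;
    0, 0, 0, Real.cos θ, 0, Real.sin θ;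
    0, 0, -Real.sin θ, 0, Real.cos θ, 0;
    0, 0, 0, -Real.sin θ, 0, Real.cos θ]

/-- Rotation of the last two coordinate planes in opposite directions. -/
def antiRotLast (θ : ℝ) : Matrix (Fin 6) (Fin 6) ℝ :=
  !![1, 0, 0, 0, 0, 0;
    0, 1, 0, 0, 0, 0;
    0, 0, Real.cos θ, 0, Real.sin θ, 0;
    0, 0, 0, Real.cos θ, 0, -Real.sin θ;
    0, 0, -Real.sin θ, 0, Real.cos θ, 0;
    0, 0, 0, Real.sin θ, 0, Real.cos θ]

lemma rotFirst_mul_transpose (θ : ℝ) : rotFirst θ * (rotFirst θ)ᵀ = 1 := by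
  have := Real.cos_sq_add_sin_sq θ
  ext i j
  fin_cases i <;> fin_cases j <;> simp [rotFirst, Matrix.mul_apply, Fin.sum_univ_six] <;> linarith

lemma rotLast_mul_transpose (θ : ℝ) : rotLast θ * (rotLast θ)ᵀ = 1 := by
  have := Real.cos_sq_add_sin_sq θ
  ext i j
  fin_cases i <;> fin_cases j <;> simp [rotLast, Matrix.mul_apply, Fin.sum_univ_six] <;> linarith

lemma antiRotLast_mul_transpose (θ : ℝ) : antiRotLast θ * (antiRotLast θ)ᵀ = 1 := by
  have := Real.cos_sq_add_sin_sq θ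
  ext i j
  fin_cases i <;> fin_cases j <;> simp [antiRotLast, Matrix.mul_apply, Fin.sum_univ_six] <;>
    linarith

lemma rotFirst_two_mul (θ : ℝ) : rotFirst (2 * θ) = rotFirst θ * rotFirst θ := by
  have := Real.cos_sq_add_sin_sq θ
  ext i j
  fin_cases i <;> fin_cases j <;>
    simp [rotFirst, Matrix.mul_apply, Fin.sum_univ_six, Real.cos_two_mul, Real.sin_two_mul] <;>
    linarith

lemma rotLast_two_mul (θ : ℝ) : rotLast (2 * θ) = rotLast θ * rotLast θ := by
  have := Real.cos_sq_add_sin_sq θ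
  ext i j
  fin_cases i <;> fin_cases j <;>
    simp [rotLast, Matrix.mul_apply, Fin.sum_univ_six, Real.cos_two_mul, Real.sin_two_mul] <;>
    linarith

lemma antiRotLast_two_mul (θ : ℝ) : antiRotLast (2 * θ) = antiRotLast θ * antiRotLast θ := by
  have := Real.cos_sq_add_sin_sq θ
  ext i j
  fin_cases i <;> fin_cases j <;>
    simp [antiRotLast, Matrix.mul_apply, Fin.sum_univ_six, Real.cos_two_mul, Real.sin_two_mul] <;>
    linarith

lemma momentImage_mix_first {D : Matrix (Fin 6) (Fin 6) ℝ} {x y z s : ℝ}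
    (h : (x, y, z) ∈ momentImage D) (hs : s ∈ Set.uIcc x y) : (s, x + y - s, z) ∈ momentImage D := by
  obtain ⟨P, hP, hdet, hμ⟩ := h
  set A := P * D * Pᵀ with hA
  simp only [μ, Prod.mk.injEq] at hμ
  obtain ⟨rfl, rfl, rfl⟩ := hμ
  obtain ⟨θ, hθ⟩ := exists_quadratic_eq (k := A 1 2 + A 3 0) hs
  have h := moment_conj_mem_momentImage hP hdet hA rotFirst rotFirst_mul_transpose rotFirst_two_mul θ
  have hsq := Real.cos_sq_add_sin_sq θ
  convert h using 1
  ext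
  · simp [μ, rotFirst, Matrix.mul_apply, Matrix.vecMul, dotProduct, Fin.sum_univ_six]
    linear_combination -hθ
  · simp [μ, rotFirst, Matrix.mul_apply, Matrix.vecMul, dotProduct, Fin.sum_univ_six]
    linear_combination hθ - (A 1 0 + A 3 2) * hsq
  · simp [μ, rotFirst, Matrix.mul_apply, Matrix.vecMul, dotProduct, Fin.sum_univ_six]

lemma momentImage_mix_last {D : Matrix (Fin 6) (Fin 6) ℝ} {x y z s : ℝ}
    (h : (x, y, z) ∈ momentImage D) (hs : s ∈ Set.uIcc y z) : (x, s, y + z - s) ∈ momentImage D := by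
  obtain ⟨P, hP, hdet, hμ⟩ := h
  set A := P * D * Pᵀ with hA
  simp only [μ, Prod.mk.injEq] at hμ
  obtain ⟨rfl, rfl, rfl⟩ := hμ
  obtain ⟨θ, hθ⟩ := exists_quadratic_eq (k := A 3 4 + A 5 2) hs
  have h := moment_conj_mem_momentImage hP hdet hA rotLast rotLast_mul_transpose rotLast_two_mul θ
  have hsq := Real.cos_sq_add_sin_sq θ
  convert h using 1
  ext
  · simp [μ, rotLast, Matrix.mul_apply, Matrix.vecMul, dotProduct, Fin.sum_univ_six]
  · simp [μ, rotLast, Matrix.mul_apply, Matrix.vecMul, dotProduct, Fin.sum_univ_six]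
    linear_combination -hθ
  · simp [μ, rotLast, Matrix.mul_apply, Matrix.vecMul, dotProduct, Fin.sum_univ_six]
    linear_combination hθ - (A 3 2 + A 5 4) * hsq

lemma momentImage_antiMix_last {D : Matrix (Fin 6) (Fin 6) ℝ} {x y z s : ℝ}
    (h : (x, y, z) ∈ momentImage D) (hs : s ∈ Set.uIcc y (-z)) :
    (x, s, z - y + s) ∈ momentImage D := by
  obtain ⟨P, hP, hdet, hμ⟩ := h
  set A := P * D * Pᵀ with hA
  simp only [μ, Prod.mk.injEq] at hμ
  obtain ⟨rfl, rfl, rfl⟩ := hμ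
  obtain ⟨θ, hθ⟩ := exists_quadratic_eq (k := A 3 4 - A 5 2) hs
  have h := moment_conj_mem_momentImage hP hdet hA antiRotLast antiRotLast_mul_transpose
    antiRotLast_two_mul θ
  have hsq := Real.cos_sq_add_sin_sq θ
  convert h using 1
  ext
  · simp [μ, antiRotLast, Matrix.mul_apply, Matrix.vecMul, dotProduct, Fin.sum_univ_six]
  · simp [μ, antiRotLast, Matrix.mul_apply, Matrix.vecMul, dotProduct, Fin.sum_univ_six]
    linear_combination -hθ
  · simp [μ, antiRotLast, Matrix.mul_apply, Matrix.vecMul, dotProduct, Fin.sum_univ_six]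
    linear_combination -hθ - (A 5 4 - A 3 2) * hsq

lemma transpose_normalForm (a b c : ℝ) :
    (a • E 0 1 + b • E 2 3 + c • E 4 5)ᵀ = -(a • E 0 1 + b • E 2 3 + c • E 4 5) := by
  ext i j
  fin_cases i <;> fin_cases j <;> simp [E]

lemma normalForm_mul_self {a b c : ℝ} (ha : a * a = 1) (hb : b * b = 1) (hc : c * c = 1) :
    (a • E 0 1 + b • E 2 3 + c • E 4 5) * (a • E 0 1 + b • E 2 3 + c • E 4 5) = -1 := by
  ext i j
  fin_cases i <;> fin_cases j <;> simp [E, Matrix.mul_apply, ha, hb, hc]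

lemma pfaffian_normalForm (a b c : ℝ) :
    pfaffian (a • E 0 1 + b • E 2 3 + c • E 4 5) = a * b * c := by
  simp [pfaffian, E, mul_assoc]

lemma momentImage_subset (l : Fin 3 → ℝ) :
    momentImage (l 0 • E 0 1 + l 1 • E 2 3 + l 2 • E 4 5) ⊆ convexHull ℝ (weylOrbit l) := by
  rintro p ⟨P, hP, hdet, rfl⟩
  have hP' : Pᵀ * P = 1 := mul_eq_one_comm.mp hP
  let M : Matrix (Fin 3) (Fin 3) ℝ := Matrix.of
    ![![(P * E 0 1 * Pᵀ) 1 0, (P * E 2 3 * Pᵀ) 1 0, (P * E 4 5 * Pᵀ) 1 0],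
      ![(P * E 0 1 * Pᵀ) 3 2, (P * E 2 3 * Pᵀ) 3 2, (P * E 4 5 * Pᵀ) 3 2],
      ![(P * E 0 1 * Pᵀ) 5 4, (P * E 2 3 * Pᵀ) 5 4, (P * E 4 5 * Pᵀ) 5 4]]
  have hμ : ∀ l : Fin 3 → ℝ, μ (P * (l 0 • E 0 1 + l 1 • E 2 3 + l 2 • E 4 5) * Pᵀ) =
      ((M *ᵥ l) 0, (M *ᵥ l) 1, (M *ᵥ l) 2) := by
    intro l
    simp only [mul_add, add_mul, Matrix.mul_smul, Matrix.smul_mul]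
    simp only [μ, Matrix.add_apply, Matrix.smul_apply, smul_eq_mul]
    simp [M, Matrix.mulVec, dotProduct, Fin.sum_univ_three, mul_comm]
  rw [hμ]
  refine mulVec_mem_convexHull_weylOrbit l M fun a b => ?_
  let J : Matrix (Fin 6) (Fin 6) ℝ :=
    (spinWeight b 0 : ℝ) • E 0 1 + (spinWeight b 1 : ℝ) • E 2 3 + (spinWeight b 2 : ℝ) • E 4 5
  have hw : ∀ i, (spinWeight b i : ℝ) * spinWeight b i = 1 := fun i => by
    fin_cases b <;> fin_cases i <;> simp [spinWeight]
  have hJ : Jᵀ = -J := transpose_normalForm _ _ _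
  have hJ2 : J * J = -1 := normalForm_mul_self (hw 0) (hw 1) (hw 2)
  have hpf : pfaffian J = 1 := by
    rw [pfaffian_normalForm]
    fin_cases b <;> simp [spinWeight]
  have key := spin_nonneg (A := P * J * Pᵀ)
    (by rw [Matrix.transpose_mul, Matrix.transpose_mul, hJ]; simp [Matrix.mul_assoc])
    (by rw [show P * J * Pᵀ * (P * J * Pᵀ) = P * J * (Pᵀ * P) * J * Pᵀ by
          simp only [Matrix.mul_assoc], hP', Matrix.mul_one, Matrix.mul_assoc P J J, hJ2]
        simp [hP])
    (by rw [pfaffian_conj P J hJ, hdet, hpf, one_mul]) a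
  have hb := hμ (fun i => (spinWeight b i : ℝ))
  simp only [μ, Prod.mk.injEq] at hb
  obtain ⟨h0, h1, h2⟩ := hb
  simp only [J, h0, h1, h2] at key
  refine key.trans_eq ?_
  simp only [Matrix.mulVec, dotProduct, Fin.sum_univ_three]
  ring

lemma le_of_mem_convexHull {V : Type*} [AddCommGroup V] [Module ℝ V] (f : V →ₗ[ℝ] ℝ) {s : Set V}
    {r : ℝ} (h : ∀ x ∈ s, f x ≤ r) {x : V} (hx : x ∈ convexHull ℝ s) : f x ≤ r :=
  convexHull_min h (convex_halfSpace_le f.isLinear r) hx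

lemma subset_momentImage (l : Fin 3 → ℝ) :
    convexHull ℝ (weylOrbit l) ⊆ momentImage (l 0 • E 0 1 + l 1 • E 2 3 + l 2 • E 4 5) := by
  intro p hp
  set D := l 0 • E 0 1 + l 1 • E 2 3 + l 2 • E 4 5 with hD
  let Q : (Fin 4 → ℝ) → Prop := fun v => ∃ q ∈ momentImage D, spinCoord q = v
  have hcoord : ∀ x y z, spinCoord (x, y, z) = ![x + y + z, x - y - z, -x + y - z, -x - y + z] := by
    intro x y z
    ext i
    fin_cases i <;> simp [spinCoord, spinWeight] <;> ring
  have h12 : ∀ a b c d s, Q ![a, b, c, d] → s ∈ Set.uIcc a b → Q ![s, a + b - s, c, d] := by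
    rintro a b c d s ⟨⟨x, y, z⟩, hq, h⟩ hs
    rw [hcoord] at h
    simp only [Matrix.vecCons_inj, and_true] at h
    obtain ⟨rfl, rfl, rfl, rfl⟩ := h
    refine ⟨_, momentImage_antiMix_last (s := (s - x + y - z) / 2) hq ?_, ?_⟩
    · rw [Set.mem_uIcc] at hs ⊢
      exact hs.imp (fun h => ⟨by linarith, by linarith⟩) (fun h => ⟨by linarith, by linarith⟩)
    · rw [hcoord]
      ext i
      fin_cases i <;> simp <;> ring
  have h23 : ∀ a b c d s, Q ![a, b, c, d] → s ∈ Set.uIcc b c → Q ![a, s, b + c - s, d] := by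
    rintro a b c d s ⟨⟨x, y, z⟩, hq, h⟩ hs
    rw [hcoord] at h
    simp only [Matrix.vecCons_inj, and_true] at h
    obtain ⟨rfl, rfl, rfl, rfl⟩ := h
    refine ⟨_, momentImage_mix_first (s := (x + y + z + s) / 2) hq ?_, ?_⟩
    · rw [Set.mem_uIcc] at hs ⊢
      exact hs.imp (fun h => ⟨by linarith, by linarith⟩) (fun h => ⟨by linarith, by linarith⟩)
    · rw [hcoord]
      ext i
      fin_cases i <;> simp <;> ring
  have h34 : ∀ a b c d s, Q ![a, b, c, d] → s ∈ Set.uIcc c d → Q ![a, b, s, c + d - s] := by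
    rintro a b c d s ⟨⟨x, y, z⟩, hq, h⟩ hs
    rw [hcoord] at h
    simp only [Matrix.vecCons_inj, and_true] at h
    obtain ⟨rfl, rfl, rfl, rfl⟩ := h
    refine ⟨_, momentImage_mix_last (s := (x + y + z + s) / 2) hq ?_, ?_⟩
    · rw [Set.mem_uIcc] at hs ⊢
      exact hs.imp (fun h => ⟨by linarith, by linarith⟩) (fun h => ⟨by linarith, by linarith⟩)
    · rw [hcoord]
      ext i
      fin_cases i <;> simp <;> ring
  have hl : Q (spinCoord (l 0, l 1, l 2)) :=
    ⟨_, ⟨1, by simp, by simp, by simp [hD, μ, E]⟩, rfl⟩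
  set c := spinCoord (l 0, l 1, l 2) with hc
  let τ := Tuple.sort (fun i => -c i)
  have hτ : Antitone (c ∘ τ) := fun i j hij => by
    simpa using Tuple.monotone_sort (fun i => -c i) hij
  have hQτ : Q (c ∘ τ) := comp_perm_of_comp_adjacent_swap (swap_of_mix h12 h23 h34) τ hl
  have horbit : ∀ q ∈ weylOrbit l, ∃ π : Equiv.Perm (Fin 4), spinCoord q = (c ∘ τ) ∘ π := by
    intro q hq
    obtain ⟨π, h⟩ := exists_perm_spinCoord hq
    exact ⟨τ⁻¹ * π, by rw [h]; ext i; simp [hc]⟩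
  generalize c ∘ τ = u at *
  have hsum : ∀ q, ∑ i, spinCoord q i = 0 := fun q => by
    rw [hcoord q.1 q.2.1 q.2.2]
    simp [Fin.sum_univ_four]
    ring
  have hQp : Q (spinCoord p) := by
    refine of_majorized h12 h23 h34 hQτ hτ (fun i => ?_) (fun i => ?_) (fun i j hij => ?_) ?_
    · refine le_of_mem_convexHull (LinearMap.proj i ∘ₗ spinCoord) (fun q hq => ?_) hp
      obtain ⟨π, h⟩ := horbit q hq
      simpa [h] using hτ (Fin.zero_le (π i))
    · refine neg_le_neg_iff.mp
        (le_of_mem_convexHull (-(LinearMap.proj i ∘ₗ spinCoord)) (fun q hq => ?_) hp)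
      obtain ⟨π, h⟩ := horbit q hq
      simpa [h] using hτ (Fin.le_last (π i))
    · refine le_of_mem_convexHull (LinearMap.proj i ∘ₗ spinCoord + LinearMap.proj j ∘ₗ spinCoord)
        (fun q hq => ?_) hp
      obtain ⟨π, h⟩ := horbit q hq
      have hne : π i ≠ π j := fun h => hij (π.injective h)
      simp only [LinearMap.add_apply, LinearMap.comp_apply, LinearMap.proj_apply, h, Function.comp]
      rcases eq_or_ne (π i) 0 with h0 | h0
      · rw [h0]
        exact add_le_add le_rfl (hτ (Fin.one_le_of_ne_zero fun h => hne (h0.trans h.symm)))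
      · rw [add_comm]
        exact add_le_add (hτ (Fin.zero_le _)) (hτ (Fin.one_le_of_ne_zero h0))
    · obtain ⟨q, -, h⟩ := hQτ
      rw [← h, hsum, hsum]
  obtain ⟨q, hq, h⟩ := hQp
  exact spinCoord_injective h ▸ hq

/-- Atiyah–Guillemin–Sternberg convexity for the coadjoint orbits of `SO(6)`:
the moment image of the `SO(6)`-conjugation orbit of
`D = λ₁E₁₂ + λ₂E₃₄ + λ₃E₅₆` is the convex hull of the Weyl group orbit of
`(λ₁, λ₂, λ₃)`, the Weyl group acting by permutations combined with an even
number of sign changes. -/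
theorem AGS_convexity_SO6 (l : Fin 3 → ℝ) :
    {p : ℝ × ℝ × ℝ | ∃ P : Matrix (Fin 6) (Fin 6) ℝ, P * Pᵀ = 1 ∧ P.det = 1 ∧
        p = μ (P * (l 0 • E 0 1 + l 1 • E 2 3 + l 2 • E 4 5) * Pᵀ)} =
    convexHull ℝ {p : ℝ × ℝ × ℝ | ∃ (σ : Equiv.Perm (Fin 3)) (ε : Fin 3 → ℝ),
        (∀ i, ε i = 1 ∨ ε i = -1) ∧ ε 0 * ε 1 * ε 2 = 1 ∧
        p = (ε 0 * l (σ 0), ε 1 * l (σ 1), ε 2 * l (σ 2))} := by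
  exact (momentImage_subset l).antisymm (subset_momentImage l)
end
end
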